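/- Let n ≥ 1 and let K₁, …, Kₙ be subsets of ℝⁿ that are locally connected in their subspace topologies and collectively nowhere flat in ℝⁿ. For every choice of sets B₁ ⊆ K₁, …, Bₙ ⊆ Kₙ such that each Bᵢ is non-meager in the subspace Kᵢ, the Minkowski sum B₁ + ⋯ + Bₙ is non-meager in ℝⁿ. -/

import Mathlib

/-- The Minkowski sum `K 0 + ⋯ + K (n-1)` of a family of sets. -/
def familySum {n : ℕ} {X : Type*} [AddCommMonoid X] (K : Fin n → Set X) : Set X :=
  {x | ∃ f : Fin n → X, (∀ i, f i ∈ K i) ∧ ∑ i, f i = x}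

/-- Sets `A 0, …, A (n-1)` in `ℝⁿ` are collectively nowhere flat if any nonempty
relatively open subsets `U i ⊆ A i` contain points `a i, b i` such that the vectors
`b i - a i` form a basis of `ℝⁿ`. -/
def CollectivelyNowhereFlat {n : ℕ} (A : Fin n → Set (Fin n → ℝ)) : Prop :=
  ∀ V : Fin n → Set (Fin n → ℝ), (∀ i, IsOpen (V i)) → (∀ i, (V i ∩ A i).Nonempty) →
    ∃ a b : Fin n → (Fin n → ℝ), (∀ i, a i ∈ V i ∩ A i) ∧ (∀ i, b i ∈ V i ∩ A i) ∧
      LinearIndependent ℝ (fun i => b i - a i) ∧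
      Submodule.span ℝ (Set.range fun i => b i - a i) = ⊤

section
open Set Topology

/-- In a product with second countable second factor, a rectangle is meagre only if one of its
sides is. -/
theorem IsMeagre.fst_or_snd_of_prod {X Y : Type*} [TopologicalSpace X] [TopologicalSpace Y]
    [SecondCountableTopology Y] {A : Set X} {B : Set Y} (h : IsMeagre (A ×ˢ B)) :
    IsMeagre A ∨ IsMeagre B := by
  obtain ⟨S, hS, hSc, hcov⟩ := isMeagre_iff_countable_union_isNowhereDense.1 h
  by_contra! hAB
  obtain ⟨hA, hB⟩ := hAB
  let 𝓑 := TopologicalSpace.countableBasis Y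
  have h𝓑 : 𝓑.Countable := TopologicalSpace.countable_countableBasis Y
  have hbasis : TopologicalSpace.IsTopologicalBasis 𝓑 :=
    TopologicalSpace.isBasis_countableBasis Y
  refine hA (IsMeagre.mono (t := A) (s := ⋃ p ∈ S ×ˢ 𝓑, {x | ∀ y ∈ p.2, (x, y) ∈ closure p.1})
    ?_ ?_)
  · intro x hx
    by_contra hcon
    refine hB (IsMeagre.mono (s := ⋃ s ∈ S, {y | (x, y) ∈ closure s}) ?_ ?_)
    · intro y hy
      obtain ⟨s, hs, hys⟩ := hcov (mk_mem_prod hx hy)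
      exact mem_biUnion hs (subset_closure hys)
    · refine isMeagre_biUnion hSc fun s hs => IsNowhereDense.isMeagre ?_
      have hcl : IsClosed {y | (x, y) ∈ closure s} :=
        isClosed_closure.preimage (Continuous.prodMk_right x)
      rw [hcl.isNowhereDense_iff, eq_empty_iff_forall_notMem]
      intro y hy
      obtain ⟨V, hV, -, hVs⟩ := hbasis.exists_subset_of_mem_open hy isOpen_interior
      exact hcon (mem_biUnion (x := (s, V)) (mk_mem_prod hs hV)
        fun z hz => show (x, z) ∈ closure s from
          interior_subset (s := {y | (x, y) ∈ closure s}) (hVs hz))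
  · refine isMeagre_biUnion (hSc.prod h𝓑) fun p hp => IsNowhereDense.isMeagre ?_
    have hcl : IsClosed {x | ∀ y ∈ p.2, (x, y) ∈ closure p.1} := by
      simp only [ofPred_forall]
      exact isClosed_biInter fun y _ => isClosed_closure.preimage (Continuous.prodMk_left y)
    rw [hcl.isNowhereDense_iff, eq_empty_iff_forall_notMem]
    intro x hx
    obtain ⟨y, hy⟩ := TopologicalSpace.nonempty_of_mem_countableBasis hp.2
    have hsub : interior {x | ∀ y ∈ p.2, (x, y) ∈ closure p.1} ×ˢ p.2 ⊆ interior (closure p.1) :=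
      interior_maximal (fun z hz => interior_subset hz.1 z.2 hz.2)
        (isOpen_interior.prod (hbasis.isOpen hp.2))
    have := hsub (mk_mem_prod hx hy)
    rw [hS p.1 hp.1] at this
    exact this

/-- A finite product of sets is meagre only if one of the factors is. -/
theorem IsMeagre.exists_of_pi {n : ℕ} {X : Fin n → Type*} [∀ i, TopologicalSpace (X i)]
    [∀ i, SecondCountableTopology (X i)] {B : ∀ i, Set (X i)} (h : IsMeagre (univ.pi B)) :
    ∃ i, IsMeagre (B i) := by
  induction n with
  | zero =>
    have : BaireSpace (∀ i, X i) := baire_of_finite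
    refine absurd h (not_isMeagre_of_isOpen ?_ ?_)
    · exact isOpen_discrete _
    · exact ⟨fun i => i.elim0, fun i => i.elim0⟩
  | succ n ih =>
    let e : X 0 × (∀ i : Fin n, X i.succ) ≃ₜ ∀ i, X i :=
      { Fin.consEquiv X with
        continuous_toFun := continuous_pi fun i => by
          refine Fin.cases ?_ (fun j => ?_) i
          · exact continuous_fst
          · exact (continuous_apply j).comp continuous_snd
        continuous_invFun := by
          refine (continuous_apply 0).prodMk (continuous_pi fun i => continuous_apply i.succ) }
    have h' := h.preimage_of_isOpenMap e.continuous e.isOpenMap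
    have heq : e ⁻¹' univ.pi B = B 0 ×ˢ univ.pi fun i : Fin n => B i.succ := by
      ext p
      simp only [mem_preimage, mem_univ_pi, mem_prod, Fin.forall_fin_succ]
      rfl
    rw [heq] at h'
    rcases h'.fst_or_snd_of_prod with h0 | h1
    · exact ⟨0, h0⟩
    · obtain ⟨i, hi⟩ := ih h1
      exact ⟨i.succ, hi⟩

/-- Points of a preconnected set are joined by chains with arbitrarily small steps. -/
theorem IsPreconnected.exists_chain {X : Type*} [PseudoMetricSpace X] {S : Set X}
    (hS : IsPreconnected S) {ε : ℝ} (hε : 0 < ε) {a b : X} (ha : a ∈ S) (hb : b ∈ S) :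
    ∃ (m : ℕ) (c : ℕ → X), c 0 = a ∧ c m = b ∧ (∀ j, c j ∈ S) ∧
      ∀ j, dist (c j) (c (j + 1)) < ε := by
  have key : Relation.ReflTransGen (fun x y => x ∈ S ∧ y ∈ S ∧ dist x y < ε) a b := by
    refine hS.induction₂ (Relation.ReflTransGen fun x y => x ∈ S ∧ y ∈ S ∧ dist x y < ε)
      (fun x hx => ?_) (fun x y z _ _ _ => Relation.ReflTransGen.trans)
      (fun x y _ _ h => ?_) ha hb
    · filter_upwards [self_mem_nhdsWithin, mem_nhdsWithin_of_mem_nhds (Metric.ball_mem_nhds x hε)]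
        with y hy hxy
      exact .single ⟨hx, hy, by rwa [dist_comm]⟩
    · have : Std.Symm (fun x y => x ∈ S ∧ y ∈ S ∧ dist x y < ε) :=
        ⟨fun x y h => ⟨h.2.1, h.1, by rw [dist_comm]; exact h.2.2⟩⟩
      exact Relation.ReflTransGen.stdSymm.symm _ _ h
  induction key using Relation.ReflTransGen.head_induction_on with
  | refl => exact ⟨0, fun _ => b, rfl, rfl, fun _ => hb, fun _ => by simpa⟩
  | @head x y h _ ih =>
    obtain ⟨m, c, h0, hm, hc, hd⟩ := ih h.2.1
    refine ⟨m + 1, fun j => Nat.casesOn j x c, rfl, hm, fun j => ?_, fun j => ?_⟩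
    · cases j with
      | zero => exact h.1
      | succ j => exact hc j
    · cases j with
      | zero =>
        change dist x (c 0) < ε
        rw [h0]
        exact h.2.2
      | succ j => exact hd j

open Complex MeasureTheory in
theorem mul_integral_cexp_affine (α β : ℝ) :
    (β : ℂ) * ∫ t in Icc (0 : ℝ) 1, cexp (2 * Real.pi * I * ((α + t * β : ℝ) : ℂ)) =
      (cexp (2 * Real.pi * I * ((α + β : ℝ) : ℂ)) - cexp (2 * Real.pi * I * (α : ℂ))) /
        (2 * Real.pi * I) := by
  have hd : ∀ t : ℝ, HasDerivAt (fun t : ℝ => cexp (2 * Real.pi * I * ((α + t * β : ℝ) : ℂ)))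
      (cexp (2 * Real.pi * I * ((α + t * β : ℝ) : ℂ)) * (2 * Real.pi * I * (β : ℂ))) t := by
    intro t
    have h1 : HasDerivAt (fun t : ℝ => α + t * β) β t := by
      simpa using ((hasDerivAt_id t).mul_const β).const_add α
    exact (h1.ofReal_comp.const_mul _).cexp
  have hint := intervalIntegral.integral_eq_sub_of_hasDerivAt (a := 0) (b := 1)
    (fun t _ => hd t) (Continuous.intervalIntegrable (by fun_prop) _ _)
  rw [intervalIntegral.integral_mul_const, intervalIntegral.integral_of_le zero_le_one,
    ← integral_Icc_eq_integral_Ioc] at hint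
  have hpi := Complex.two_pi_I_ne_zero
  rw [eq_div_iff hpi]
  simp only [one_mul, zero_mul, add_zero] at hint
  rw [← hint]
  ring

theorem integral_mFourier {d : Type*} [Fintype d] (k : d → ℤ) [Decidable (k = 0)] :
    ∫ x, UnitAddTorus.mFourier k x
      ∂(MeasureTheory.Measure.pi fun _ : d => AddCircle.haarAddCircle (T := 1)) =
      if k = 0 then 1 else 0 := by
  simp only [UnitAddTorus.mFourier, ContinuousMap.coe_mk]
  rw [MeasureTheory.integral_fintype_prod_eq_prod
    (μ := fun _ : d => AddCircle.haarAddCircle (T := 1)) (fun i => fourier (k i))]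
  split_ifs with h
  · simp [h]
  · obtain ⟨i, hi⟩ := Function.ne_iff.mp h
    apply Finset.prod_eq_zero (Finset.mem_univ i)
    have := congrFun (fourierCoeff_fourier (T := 1) (k i)) 0
    rw [Pi.single_eq_of_ne (show (0 : ℤ) ≠ k i from Ne.symm hi)] at this
    simpa [fourierCoeff] using this

theorem mFourier_coe {d : Type*} [Fintype d] (k : d → ℤ) (y : d → ℝ) :
    UnitAddTorus.mFourier k (fun l => (y l : UnitAddCircle)) =
      Complex.exp (2 * Real.pi * Complex.I * ((∑ l, k l * y l : ℝ) : ℂ)) := by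
  simp only [UnitAddTorus.mFourier, ContinuousMap.coe_mk, fourier_coe_apply, ← Complex.exp_sum]
  congr 1
  push_cast
  rw [Finset.mul_sum]
  refine Finset.sum_congr rfl fun l _ => ?_
  ring

open MeasureTheory in
/-- Integration of `φ ∘ f` against a finite measure, as a continuous linear functional of `φ`. -/
noncomputable def integralCompCLM {T X : Type*} [MeasurableSpace T] [TopologicalSpace T]
    [OpensMeasurableSpace T] [TopologicalSpace X] [CompactSpace X]
    (ν : Measure T) [IsFiniteMeasure ν] (f : C(T, X)) :
    C(X, ℂ) →L[ℂ] ℂ :=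
  have hint (φ : C(X, ℂ)) : Integrable (fun t => φ (f t)) ν :=
    .of_bound (φ.comp f).continuous.aestronglyMeasurable ‖φ‖
      (.of_forall fun t => φ.norm_coe_le_norm _)
  LinearMap.mkContinuous
    { toFun := fun φ => ∫ t, φ (f t) ∂ν
      map_add' := fun φ ψ => integral_add (hint φ) (hint ψ)
      map_smul' := fun c φ => integral_const_mul c _ }
    (ν.real univ) fun φ => by
      rw [mul_comm]
      exact norm_integral_le_of_norm_le_const (.of_forall fun t => φ.norm_coe_le_norm _)

section
open MeasureTheory Complex

theorem continuous_torus_coe {d : Type*} :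
    Continuous fun (y : d → ℝ) (l : d) => (y l : UnitAddCircle) :=
  continuous_pi fun l => (AddCircle.continuous_mk' 1).comp (continuous_apply l)

theorem dist_torus_coe_le {d : Type*} [Fintype d] (x y : d → ℝ) :
    dist (fun l => (x l : UnitAddCircle)) (fun l => (y l : UnitAddCircle)) ≤ dist x y := by
  refine (dist_pi_le_iff dist_nonneg).2 fun l => ?_
  refine le_trans ?_ (dist_le_pi_dist x y l)
  rw [dist_eq_norm, dist_eq_norm, ← AddCircle.coe_sub]
  exact QuotientAddGroup.norm_mk_le_norm

/-- The polygonal chains `c i`, which advance by the standard basis vectors, sum up to a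
multilinear signed cover of the torus with constant total multiplicity one. -/
theorem sum_det_mul_integral_eq {n : ℕ} (m : Fin n → ℕ) (c : Fin n → ℕ → Fin n → ℝ)
    (hc : ∀ i, c i (m i) = c i 0 + Pi.single i 1) (φ : C(UnitAddTorus (Fin n), ℂ)) :
    ∑ J : ∀ i, Fin (m i),
      (Matrix.of fun i l => ((c i (J i + 1) l - c i (J i) l : ℝ) : ℂ)).det *
        ∫ t, φ (fun l => ((∑ i, (c i (J i) + t i • (c i (J i + 1) - c i (J i)))) l :
          UnitAddCircle)) ∂(Measure.pi fun _ : Fin n => volume.restrict (Icc (0 : ℝ) 1)) =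
      ∫ x, φ x ∂(Measure.pi fun _ : Fin n => AddCircle.haarAddCircle (T := 1)) := by
  classical
  let ν : Measure (Fin n → ℝ) := Measure.pi fun _ => volume.restrict (Icc (0 : ℝ) 1)
  let f (J : ∀ i, Fin (m i)) : C(Fin n → ℝ, UnitAddTorus (Fin n)) :=
    ⟨fun t l => ((∑ i, (c i (J i) + t i • (c i (J i + 1) - c i (J i)))) l : UnitAddCircle),
      continuous_torus_coe.comp (by fun_prop)⟩
  let Λ : C(UnitAddTorus (Fin n), ℂ) →L[ℂ] ℂ := ∑ J : ∀ i, Fin (m i),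
    (Matrix.of fun i l => ((c i (J i + 1) l - c i (J i) l : ℝ) : ℂ)).det •
      integralCompCLM ν (f J)
  let L : C(UnitAddTorus (Fin n), ℂ) →L[ℂ] ℂ :=
    integralCompCLM (Measure.pi fun _ : Fin n => AddCircle.haarAddCircle (T := 1)) (.id _)
  have hΛ φ : Λ φ = ∑ J : ∀ i, Fin (m i),
      (Matrix.of fun i l => ((c i (J i + 1) l - c i (J i) l : ℝ) : ℂ)).det *
        ∫ t, φ (f J t) ∂ν := by
    simp only [Λ, FunLike.coe_sum, Finset.sum_apply, FunLike.coe_smul, Pi.smul_apply, smul_eq_mul]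
    rfl
  suffices h : Λ = L by
    have h' := DFunLike.congr_fun h φ
    rw [hΛ] at h'
    exact h'
  refine ContinuousLinearMap.ext_on (s := range (UnitAddTorus.mFourier (d := Fin n))) ?_ ?_
  · rw [Submodule.dense_iff_topologicalClosure_eq_top]
    exact UnitAddTorus.span_mFourier_closure_eq_top
  rintro _ ⟨k, rfl⟩
  have hL : L (UnitAddTorus.mFourier k) = if k = 0 then 1 else 0 := integral_mFourier k
  rw [hL, hΛ]
  let α (i : Fin n) (j : ℕ) : ℝ := ∑ l, k l * c i j l
  let E (i : Fin n) (j : ℕ) : ℂ := ∫ t in Icc (0 : ℝ) 1,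
    cexp (2 * Real.pi * I * ((α i j + t * (α i (j + 1) - α i j) : ℝ) : ℂ))
  have hint (J : ∀ i, Fin (m i)) :
      ∫ t, UnitAddTorus.mFourier k (f J t) ∂ν = ∏ i, E i (J i) := by
    rw [← integral_fintype_prod_eq_prod (μ := fun _ => volume.restrict (Icc (0 : ℝ) 1))
      (fun i t => cexp (2 * Real.pi * I *
        ((α i (J i) + t * (α i (J i + 1) - α i (J i)) : ℝ) : ℂ)))]
    refine integral_congr_ae (.of_forall fun t => ?_)
    simp only [f, ContinuousMap.coe_mk, mFourier_coe, ← Complex.exp_sum, ← Finset.mul_sum,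
      ← Complex.ofReal_sum]
    congr 3
    simp only [Finset.sum_apply, Pi.add_apply, Pi.smul_apply, Pi.sub_apply, smul_eq_mul,
      Finset.mul_sum, α]
    rw [Finset.sum_comm]
    refine Finset.sum_congr rfl fun i _ => ?_
    rw [← Finset.sum_sub_distrib, Finset.mul_sum, ← Finset.sum_add_distrib]
    exact Finset.sum_congr rfl fun l _ => by ring
  have hdet : ∑ J : ∀ i, Fin (m i),
      (Matrix.of fun i l => ((c i (J i + 1) l - c i (J i) l : ℝ) : ℂ)).det *
        ∫ t, UnitAddTorus.mFourier k (f J t) ∂ν =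
      (Matrix.of fun i l => ∑ j : Fin (m i),
        E i j * ((c i (j + 1) l - c i j l : ℝ) : ℂ)).det := by
    have h1 := (Matrix.detRowAlternating (n := Fin n) (R := ℂ)).toMultilinearMap.map_sum
      (fun i (j : Fin (m i)) => E i j • fun l => ((c i (j + 1) l - c i j l : ℝ) : ℂ))
    simp only [MultilinearMap.map_smul_univ] at h1
    convert h1.symm using 1
    · refine Finset.sum_congr rfl fun J _ => ?_
      rw [hint, mul_comm]
      rfl
    · change Matrix.det _ = Matrix.det _
      congr 1
      ext i l
      simp
  rw [hdet]
  split_ifs with hk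
  · rw [← Matrix.det_one (n := Fin n) (R := ℂ)]
    congr 1
    ext i l
    have hE (j : ℕ) : E i j = 1 := by simp [E, α, hk]
    simp only [Matrix.of_apply, hE, one_mul, ← Complex.ofReal_sum]
    rw [Fin.sum_univ_eq_sum_range (fun j => c i (j + 1) l - c i j l), Finset.sum_range_sub
      (fun j => c i j l), hc, Pi.add_apply, add_sub_cancel_left, Matrix.one_apply,
      Pi.single_apply]
    simp only [eq_comm (a := l)]
    split_ifs <;> simp
  · refine Matrix.exists_mulVec_eq_zero_iff.1 ⟨fun l => (k l : ℂ), ?_, ?_⟩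
    · obtain ⟨l, hl⟩ := Function.ne_iff.1 hk
      exact Function.ne_iff.2 ⟨l, by simpa using hl⟩
    · ext i
      have hterm (j : ℕ) : ∑ l, E i j * ((c i (j + 1) l - c i j l : ℝ) : ℂ) * (k l : ℂ) =
          cexp (2 * Real.pi * I * (α i (j + 1) : ℂ)) / (2 * Real.pi * I) -
            cexp (2 * Real.pi * I * (α i j : ℂ)) / (2 * Real.pi * I) := by
        have := mul_integral_cexp_affine (α i j) (α i (j + 1) - α i j)
        rw [add_sub_cancel] at this
        rw [← sub_div, ← this]
        change _ = _ * E i j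
        simp only [α, ← Finset.sum_sub_distrib]
        push_cast
        rw [Finset.sum_mul]
        exact Finset.sum_congr rfl fun l _ => by ring
      have hα : α i (m i) = α i 0 + k i := by
        simp only [α, hc, Pi.add_apply, mul_add, Finset.sum_add_distrib]
        simp [Pi.single_apply]
      simp only [Matrix.mulVec, dotProduct, Matrix.of_apply, Finset.sum_mul, Pi.zero_apply]
      rw [Finset.sum_comm]
      simp only [hterm]
      rw [Fin.sum_univ_eq_sum_range (fun j => cexp (2 * Real.pi * I * (α i (j + 1) : ℂ)) /
        (2 * Real.pi * I) - cexp (2 * Real.pi * I * (α i j : ℂ)) / (2 * Real.pi * I)),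
        Finset.sum_range_sub (fun j => cexp (2 * Real.pi * I * (α i j : ℂ)) /
        (2 * Real.pi * I)), hα]
      have : cexp (2 * Real.pi * I * ((α i 0 + k i : ℝ) : ℂ)) =
          cexp (2 * Real.pi * I * (α i 0 : ℂ)) := by
        push_cast
        rw [mul_add, Complex.exp_add, mul_comm (2 * Real.pi * I) (k i : ℂ),
          Complex.exp_int_mul_two_pi_mul_I, mul_one]
      rw [this, sub_self]

/-- Preconnected sets joining `a i` to `a i + e i` have a Minkowski sum that is dense
modulo the integer lattice. -/
theorem dense_torus_image_familySum {n : ℕ} {C : Fin n → Set (Fin n → ℝ)}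
    (hC : ∀ i, IsPreconnected (C i)) {a : Fin n → Fin n → ℝ} (ha : ∀ i, a i ∈ C i)
    (hb : ∀ i, a i + Pi.single i 1 ∈ C i) :
    Dense ((fun (y : Fin n → ℝ) l => (y l : UnitAddCircle)) '' familySum C) := by
  rw [Metric.dense_iff_iUnion_ball]
  by_contra hcon
  push Not at hcon
  obtain ⟨r, hr, hne⟩ := hcon
  obtain ⟨p, hp⟩ := (ne_univ_iff_exists_notMem _).1 hne
  have hfar : ∀ s ∈ familySum C, r ≤ dist p (fun l => (s l : UnitAddCircle)) := by
    intro s hs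
    by_contra! hlt
    exact hp (mem_biUnion (mem_image_of_mem _ hs) hlt)
  have hε : 0 < r / 2 / (n + 1) := by positivity
  choose m c hc0 hcm hcC hcd using fun i => (hC i).exists_chain hε (ha i) (hb i)
  let ψ : C(UnitAddTorus (Fin n), ℝ) := ⟨fun y => max 0 (r / 2 - dist p y), by fun_prop⟩
  let φ : C(UnitAddTorus (Fin n), ℂ) := ⟨fun y => (ψ y : ℂ), by fun_prop⟩
  have key := sum_det_mul_integral_eq m c (fun i => by rw [hcm, hc0]) φ
  have hpos : 0 < ∫ x, ψ x ∂(Measure.pi fun _ : Fin n => AddCircle.haarAddCircle (T := 1)) := by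
    refine Continuous.integral_pos_of_hasCompactSupport_nonneg_nonzero (x := p) ψ.continuous
      (.of_compactSpace _) (fun y => le_max_left _ _) ?_
    simp [ψ, hr]
  have hR : ∫ x, φ x ∂(Measure.pi fun _ : Fin n => AddCircle.haarAddCircle (T := 1)) =
      ((∫ x, ψ x ∂(Measure.pi fun _ : Fin n => AddCircle.haarAddCircle (T := 1)) : ℝ) : ℂ) :=
    integral_ofReal
  rw [hR, Finset.sum_eq_zero] at key
  · exact hpos.ne (by exact_mod_cast key)
  intro J _
  rw [integral_eq_zero_of_ae, mul_zero]
  rw [← Measure.restrict_pi_pi]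
  refine ae_restrict_of_forall_mem (MeasurableSet.univ_pi fun _ => measurableSet_Icc)
    fun t ht => ?_
  have hs := hfar (∑ i, c i (J i)) ⟨fun i => c i (J i), fun i => hcC i _, rfl⟩
  have hd : dist (∑ i, (c i (J i) + t i • (c i (J i + 1) - c i (J i)))) (∑ i, c i (J i)) ≤
      r / 2 := by
    rw [dist_eq_norm, ← Finset.sum_sub_distrib]
    calc _ ≤ ∑ i : Fin n, r / 2 / (n + 1) := by
          refine norm_sum_le_of_le _ fun i _ => ?_
          rw [add_sub_cancel_left, norm_smul, Real.norm_of_nonneg (ht i trivial).1]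
          refine (mul_le_of_le_one_left (norm_nonneg _) (ht i trivial).2).trans ?_
          rw [← dist_eq_norm, dist_comm]
          exact (hcd i _).le
      _ ≤ r / 2 := by
          rw [Finset.sum_const, Finset.card_univ, Fintype.card_fin, nsmul_eq_mul, ← mul_div_assoc,
            div_le_iff₀ (by positivity)]
          nlinarith
  have h1 := dist_torus_coe_le (∑ i, (c i (J i) + t i • (c i (J i + 1) - c i (J i))))
    (∑ i, c i (J i))
  have h2 := dist_triangle p
    (fun l => ((∑ i, (c i (J i) + t i • (c i (J i + 1) - c i (J i)))) l : UnitAddCircle))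
    (fun l => ((∑ i, c i (J i)) l : UnitAddCircle))
  change ((max 0 (r / 2 - dist p _) : ℝ) : ℂ) = 0
  rw [Complex.ofReal_eq_zero, max_eq_left]
  linarith
end

theorem isBounded_familySum {n : ℕ} {E : Type*} [SeminormedAddCommGroup E] {C : Fin n → Set E}
    (hC : ∀ i, Bornology.IsBounded (C i)) : Bornology.IsBounded (familySum C) := by
  choose R hR using fun i => (hC i).exists_norm_le
  refine isBounded_iff_forall_norm_le.2 ⟨∑ i, R i, ?_⟩
  rintro _ ⟨f, hf, rfl⟩
  exact norm_sum_le_of_le _ fun i _ => hR i _ (hf i)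

theorem nonempty_interior_closure_familySum_of_add_single {n : ℕ} {C : Fin n → Set (Fin n → ℝ)}
    (hC : ∀ i, IsPreconnected (C i)) (hbdd : ∀ i, Bornology.IsBounded (C i))
    {a : Fin n → Fin n → ℝ} (ha : ∀ i, a i ∈ C i) (hb : ∀ i, a i + Pi.single i 1 ∈ C i) :
    (interior (closure (familySum C))).Nonempty := by
  have hcomp : IsCompact (closure (familySum C)) := (isBounded_familySum hbdd).isCompact_closure
  have himage : (fun (y : Fin n → ℝ) l => (y l : UnitAddCircle)) '' closure (familySum C) =
      univ := by
    rw [← (hcomp.image continuous_torus_coe).isClosed.closure_eq]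
    exact ((dense_torus_image_familySum hC ha hb).mono (image_mono subset_closure)).closure_eq
  have hcover : ⋃ z : Fin n → ℤ,
      (Homeomorph.addRight fun l => (z l : ℝ)) ⁻¹' closure (familySum C) = univ := by
    refine eq_univ_of_forall fun x => ?_
    obtain ⟨y, hy, hyx⟩ := himage.ge (mem_univ fun l => (x l : UnitAddCircle))
    have hz (l : Fin n) : ∃ z : ℤ, x l + z = y l := by
      have hl : ((y l - x l : ℝ) : UnitAddCircle) = 0 := by
        rw [AddCircle.coe_sub, sub_eq_zero]
        exact congrFun hyx l
      obtain ⟨z, hz⟩ := (AddCircle.coe_eq_zero_iff 1).1 hl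
      refine ⟨z, ?_⟩
      rw [zsmul_eq_mul, mul_one] at hz
      rw [hz, add_sub_cancel]
    choose z hz using hz
    refine mem_iUnion.2 ⟨z, ?_⟩
    have : x + (fun l => (z l : ℝ)) = y := funext hz
    simpa [this] using hy
  obtain ⟨z, hz⟩ := nonempty_interior_of_iUnion_of_closed
    (fun z => isClosed_closure.preimage (Homeomorph.addRight _).continuous) hcover
  rw [← Homeomorph.preimage_interior] at hz
  exact nonempty_of_nonempty_preimage hz

theorem LinearMap.image_familySum {n : ℕ} {R E F : Type*} [Semiring R] [AddCommMonoid E]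
    [AddCommMonoid F] [Module R E] [Module R F] (T : E →ₗ[R] F) (C : Fin n → Set E) :
    T '' familySum C = familySum fun i => T '' C i := by
  ext y
  constructor
  · rintro ⟨_, ⟨f, hf, rfl⟩, rfl⟩
    exact ⟨fun i => T (f i), fun i => mem_image_of_mem _ (hf i), (map_sum T _ _).symm⟩
  · rintro ⟨g, hg, rfl⟩
    choose f hf hfg using hg
    exact ⟨_, ⟨f, hf, rfl⟩, by simp only [map_sum, hfg]⟩

/-- Bounded preconnected sets containing the endpoints of `n` linearly independent segments
have a Minkowski sum that is somewhere dense. -/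
theorem nonempty_interior_closure_familySum {n : ℕ} {C : Fin n → Set (Fin n → ℝ)}
    (hC : ∀ i, IsPreconnected (C i)) (hbdd : ∀ i, Bornology.IsBounded (C i))
    {a b : Fin n → Fin n → ℝ} (ha : ∀ i, a i ∈ C i) (hb : ∀ i, b i ∈ C i)
    (hli : LinearIndependent ℝ fun i => b i - a i)
    (hspan : Submodule.span ℝ (range fun i => b i - a i) = ⊤) :
    (interior (closure (familySum C))).Nonempty := by
  let T : (Fin n → ℝ) ≃L[ℝ] (Fin n → ℝ) :=
    (Module.Basis.mk hli hspan.ge).equivFun.toContinuousLinearEquiv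
  have hT (i : Fin n) : T (b i) = T (a i) + Pi.single i 1 := by
    rw [← sub_eq_iff_eq_add', ← map_sub]
    have := (Module.Basis.mk hli hspan.ge).equivFun_self i
    rw [Module.Basis.mk_apply] at this
    ext j
    exact (this j).trans (by simp [Pi.single_apply, eq_comm])
  have h := nonempty_interior_closure_familySum_of_add_single (C := fun i => T '' C i)
    (a := fun i => T (a i)) (fun i => (hC i).image _ T.continuous.continuousOn)
    (fun i => T.lipschitz.isBounded_image (hbdd i)) (fun i => mem_image_of_mem _ (ha i))
    (fun i => hT i ▸ mem_image_of_mem _ (hb i))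
  have himage : familySum (fun i => T '' C i) = T.toHomeomorph '' familySum C :=
    (LinearMap.image_familySum (T : (Fin n → ℝ) →ₗ[ℝ] (Fin n → ℝ)) C).symm
  rw [himage] at h
  rwa [← T.toHomeomorph.image_closure, ← T.toHomeomorph.image_interior, image_nonempty] at h

theorem IsNowhereDense.preimage_sum_of_collectivelyNowhereFlat {n : ℕ}
    {K : Fin n → Set (Fin n → ℝ)} (hloc : ∀ i, LocallyConnectedSpace (K i))
    (hcnf : CollectivelyNowhereFlat K) {N : Set (Fin n → ℝ)} (hN : IsNowhereDense N) :
    IsNowhereDense ((fun f : ∀ i, K i => ∑ i, (f i : Fin n → ℝ)) ⁻¹' N) := by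
  have hcont : Continuous fun f : ∀ i, K i => ∑ i, (f i : Fin n → ℝ) := by fun_prop
  refine IsNowhereDense.mono (preimage_mono subset_closure) ?_
  rw [(isClosed_closure.preimage hcont).isNowhereDense_iff, eq_empty_iff_forall_notMem]
  intro x hx
  obtain ⟨U, hU, hUsub⟩ := isOpen_pi_iff'.1 isOpen_interior x hx
  have hV (i : Fin n) := locallyConnectedSpace_iff_subsets_isOpen_isConnected.1 (hloc i) (x i)
    (U i ∩ Metric.ball (x i) 1)
    (Filter.inter_mem ((hU i).1.mem_nhds (hU i).2) (Metric.ball_mem_nhds _ one_pos))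
  choose V hVU hVo hxV hVc using hV
  choose O hO hOV using fun i => isOpen_induced_iff.1 (hVo i)
  have hOK (i : Fin n) : O i ∩ K i = Subtype.val '' V i := by
    rw [← hOV, Subtype.image_preimage_coe, inter_comm]
  obtain ⟨a, b, ha, hb, hli, hspan⟩ := hcnf O hO fun i => by
    rw [hOK]
    exact ⟨_, mem_image_of_mem _ (hxV i)⟩
  simp only [hOK] at ha hb
  have hne := nonempty_interior_closure_familySum
    (fun i => ((hVc i).isPreconnected.image _ continuous_subtype_val.continuousOn))
    (fun i => (Metric.isBounded_ball (x := (x i : Fin n → ℝ)) (r := 1)).subset <|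
      image_subset_iff.2 fun y hy => (hVU i hy).2)
    ha hb hli hspan
  have hsub : familySum (fun i => Subtype.val '' V i) ⊆ closure N := by
    rintro _ ⟨f, hf, rfl⟩
    choose g hg hgf using hf
    have hgN := interior_subset (hUsub fun i _ => (hVU i (hg i)).1)
    simpa only [mem_preimage, hgf] using hgN
  have := hne.mono (interior_mono (closure_minimal hsub isClosed_closure))
  rw [hN] at this
  exact not_nonempty_empty this

theorem IsMeagre.preimage_sum_of_collectivelyNowhereFlat {n : ℕ}
    {K : Fin n → Set (Fin n → ℝ)} (hloc : ∀ i, LocallyConnectedSpace (K i))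
    (hcnf : CollectivelyNowhereFlat K) {M : Set (Fin n → ℝ)} (hM : IsMeagre M) :
    IsMeagre ((fun f : ∀ i, K i => ∑ i, (f i : Fin n → ℝ)) ⁻¹' M) := by
  obtain ⟨S, hS, hSc, hcov⟩ := isMeagre_iff_countable_union_isNowhereDense.1 hM
  rw [sUnion_eq_biUnion] at hcov
  refine IsMeagre.mono (preimage_mono hcov) ?_
  rw [preimage_iUnion₂]
  exact isMeagre_biUnion hSc fun s hs =>
    ((hS s hs).preimage_sum_of_collectivelyNowhereFlat hloc hcnf).isMeagre

end

theorem sum_nonmeager_of_collectively_nowhere_flat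
    {n : ℕ} (hn : 0 < n) (K : Fin n → Set (Fin n → ℝ))
    (hloc : ∀ i, LocallyConnectedSpace ↥(K i))
    (hcnf : CollectivelyNowhereFlat K)
    (B : Fin n → Set (Fin n → ℝ)) (hBK : ∀ i, B i ⊆ K i)
    (hB : ∀ i, ¬ IsMeagre ((Subtype.val ⁻¹' B i) : Set ↥(K i))) :
    ¬ IsMeagre (familySum B) := by
  intro hM
  have hpre := hM.preimage_sum_of_collectivelyNowhereFlat hloc hcnf
  have hpi : IsMeagre (Set.univ.pi fun i => (Subtype.val ⁻¹' B i : Set (K i))) :=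
    hpre.mono fun f hf =>
      show ∑ i, (f i : Fin n → ℝ) ∈ familySum B from ⟨fun i => f i, fun i => hf i trivial, rfl⟩
  obtain ⟨i, hi⟩ := hpi.exists_of_pi
  exact hB i hi
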